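/- Let b : ℝ≥0 → ℝ≥0 be a smooth function, regularly varying at infinity with exponent α > 0, satisfying b(x+y) ≤ C(b(x)+b(y)) for all x,y ≥ 0 and some constant C. Then there exists a smooth, nondecreasing, concave function f on [0,∞) with f(0)=0, f'(0+) < ∞, lim_{x→∞} f(x)=∞, such that b(log x) ∼ f(x) as x → ∞ and f(xy) ≤ C'(f(x)+f(y)) for all x,y ≥ 0 and some constant C' < ∞. -/

import Mathlib

open Set Filter Real
open scoped Topology

/-- A regularly varying function is eventually positive. -/
theorem eventually_pos_of_regVar {b : ℝ → ℝ} {α : ℝ} (hnn : ∀ x, 0 ≤ b x)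
    (hrv : ∀ c : ℝ, 0 < c → Tendsto (fun x => b (c * x) / b x) atTop (𝓝 (c ^ α))) :
    ∀ᶠ x in atTop, 0 < b x := by
  have h := (hrv 1 one_pos).eventually (lt_mem_nhds (rpow_pos_of_pos one_pos α))
  filter_upwards [h] with x hx
  refine lt_of_le_of_ne (hnn x) fun h0 => ?_
  simp [← h0] at hx

theorem eventually_le_two_mul_of_regVar {b : ℝ → ℝ} {α : ℝ} (hnn : ∀ x, 0 ≤ b x)
    (hrv : ∀ c : ℝ, 0 < c → Tendsto (fun x => b (c * x) / b x) atTop (𝓝 (c ^ α))) (u : ℝ) :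
    ∀ᶠ x in atTop, b (exp u * x) ≤ 2 * exp (α * u) * b x := by
  have h1 : exp u ^ α = exp (α * u) := by rw [← exp_mul, mul_comm]
  have h2 : exp u ^ α < 2 * exp (α * u) := by rw [h1]; linarith [exp_pos (α * u)]
  have h := (hrv (exp u) (exp_pos u)).eventually (gt_mem_nhds h2)
  filter_upwards [h, eventually_pos_of_regVar hnn hrv] with x hx hp
  exact ((div_lt_iff₀ hp).1 hx).le

/-- A local uniform bound for regularly varying functions, from the Baire category theorem. -/
theorem exists_local_bound_of_regVar {b : ℝ → ℝ} {α : ℝ} (hα : 0 < α) (hc : Continuous b)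
    (hnn : ∀ x, 0 ≤ b x)
    (hrv : ∀ c : ℝ, 0 < c → Tendsto (fun x => b (c * x) / b x) atTop (𝓝 (c ^ α))) :
    ∃ δ > 0, ∃ Y > 0, ∀ v ∈ Icc (-δ) 0, ∀ y ≥ Y, b (exp v * y) ≤ 4 * b y := by
  let E : ℕ → Set ℝ := fun n => {u | ∀ x : ℝ, (n : ℝ) ≤ x → b (exp u * x) ≤ 2 * exp (α * u) * b x}
  have hE : ∀ n, IsClosed (E n) := fun n => by
    simp only [E, ofPred_forall]
    refine isClosed_iInter fun x => isClosed_iInter fun _ => ?_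
    exact isClosed_le (by fun_prop) (by fun_prop)
  have hU : ⋃ n, E n = univ := by
    refine eq_univ_of_forall fun u => ?_
    obtain ⟨X, hX⟩ := eventually_atTop.1 (eventually_le_two_mul_of_regVar hnn hrv u)
    obtain ⟨n, hn⟩ := exists_nat_ge X
    exact mem_iUnion.2 ⟨n, fun x hx => hX x (hn.trans hx)⟩
  obtain ⟨n, u₀, hu₀⟩ := nonempty_interior_of_iUnion_of_closed hE hU
  obtain ⟨ε, hε, hball⟩ := Metric.isOpen_iff.1 isOpen_interior u₀ hu₀
  obtain ⟨X, hX⟩ := eventually_atTop.1 (eventually_le_two_mul_of_regVar hnn hrv (-u₀))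
  refine ⟨ε / 2, by positivity, max (max X (exp u₀ * n)) 1, by positivity, fun v hv y hy => ?_⟩
  have hy1 : X ≤ y := (le_max_left _ _).trans ((le_max_left _ _).trans hy)
  have hy2 : exp u₀ * n ≤ y := (le_max_right _ _).trans ((le_max_left _ _).trans hy)
  have hmem : u₀ + v ∈ E n := interior_subset <| hball <| by
    rw [Metric.mem_ball, dist_eq, add_sub_cancel_left, abs_of_nonpos hv.2]
    linarith [hv.1]
  have hx : (n : ℝ) ≤ exp (-u₀) * y := by
    rw [exp_neg, inv_mul_eq_div, le_div_iff₀ (exp_pos _)]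
    linarith
  have h1 := hmem _ hx
  have h2 := hX y hy1
  have e1 : exp (u₀ + v) * (exp (-u₀) * y) = exp v * y := by
    rw [← mul_assoc, ← exp_add]; ring_nf
  have e2 : exp (α * (u₀ + v)) * exp (α * -u₀) = exp (α * v) := by
    rw [← exp_add]; ring_nf
  rw [e1] at h1
  calc b (exp v * y) ≤ 2 * exp (α * (u₀ + v)) * b (exp (-u₀) * y) := h1
    _ ≤ 2 * exp (α * (u₀ + v)) * (2 * exp (α * -u₀) * b y) := by gcongr
    _ = 4 * (exp (α * (u₀ + v)) * exp (α * -u₀)) * b y := by ring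
    _ ≤ 4 * 1 * b y := by
      rw [e2]
      have := hnn y
      gcongr
      exact exp_le_one_iff.2 (mul_nonpos_of_nonneg_of_nonpos hα.le hv.2)
    _ = 4 * b y := by ring

/-- A regularly varying function of positive index is eventually quasi-increasing. -/
theorem exists_le_mul_of_regVar {b : ℝ → ℝ} {α : ℝ} (hα : 0 < α) (hc : Continuous b)
    (hnn : ∀ x, 0 ≤ b x)
    (hrv : ∀ c : ℝ, 0 < c → Tendsto (fun x => b (c * x) / b x) atTop (𝓝 (c ^ α))) :
    ∃ Y > 0, ∀ x y, Y ≤ x → x ≤ y → b x ≤ 4 * b y := by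
  obtain ⟨δ, hδ, Y₀, hY₀, hloc⟩ := exists_local_bound_of_regVar hα hc hnn hrv
  have hθ : exp (-δ) < 1 := exp_lt_one_iff.2 (by linarith)
  have hdec : ∀ᶠ y in atTop, b (exp (-δ) * y) ≤ b y := by
    have h := (hrv _ (exp_pos (-δ))).eventually
      (gt_mem_nhds (rpow_lt_one (exp_pos _).le hθ hα))
    filter_upwards [h, eventually_pos_of_regVar hnn hrv] with y hy hp
    simpa using ((div_lt_iff₀ hp).1 hy).le
  obtain ⟨Y₁, hY₁⟩ := eventually_atTop.1 hdec
  have key : ∀ n : ℕ, ∀ x y, max Y₀ Y₁ ≤ x → x ≤ y → exp (-δ) ^ n * y ≤ x → b x ≤ 4 * b y := by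
    intro n
    induction n with
    | zero =>
      intro x y _ hxy h
      have : x = y := le_antisymm hxy (by simpa using h)
      subst this
      linarith [hnn x]
    | succ n ih =>
      intro x y hx hxy h
      have hx0 : 0 < x := hY₀.trans_le ((le_max_left _ _).trans hx)
      have hy0 : 0 < y := hx0.trans_le hxy
      rcases le_total (exp (-δ) * y) x with hle | hle
      · have hv : log (x / y) ∈ Icc (-δ) 0 := by
          constructor
          · rw [le_log_iff_exp_le (by positivity), le_div_iff₀ hy0]
            exact hle
          · exact log_nonpos (by positivity) ((div_le_one hy0).2 hxy)
        have := hloc _ hv y (((le_max_left _ _).trans hx).trans hxy)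
        rwa [exp_log (by positivity), div_mul_cancel₀ _ hy0.ne'] at this
      · have h1 := ih x (exp (-δ) * y) hx hle (by rw [← mul_assoc, ← pow_succ]; exact h)
        have h2 := hY₁ y (((le_max_right _ _).trans hx).trans hxy)
        linarith
  refine ⟨max Y₀ Y₁, lt_max_of_lt_left hY₀, fun x y hx hxy => ?_⟩
  have hx0 : 0 < x := hY₀.trans_le ((le_max_left _ _).trans hx)
  obtain ⟨n, hn⟩ := exists_pow_lt_of_lt_one (div_pos hx0 (hx0.trans_le hxy)) hθ
  exact key n x y hx hxy ((lt_div_iff₀ (hx0.trans_le hxy)).1 hn).le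

theorem exists_pos_le_of_regVar {b : ℝ → ℝ} {α : ℝ} (hα : 0 < α) (hc : Continuous b)
    (hnn : ∀ x, 0 ≤ b x)
    (hrv : ∀ c : ℝ, 0 < c → Tendsto (fun x => b (c * x) / b x) atTop (𝓝 (c ^ α))) :
    ∃ ε > 0, ∀ᶠ x in atTop, ε ≤ b x := by
  obtain ⟨Y, hY, hle⟩ := exists_le_mul_of_regVar hα hc hnn hrv
  obtain ⟨x₀, hx₀, hx₀Y⟩ :=
    ((eventually_pos_of_regVar hnn hrv).and (eventually_ge_atTop Y)).exists
  refine ⟨b x₀ / 4, by positivity, ?_⟩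
  filter_upwards [eventually_ge_atTop x₀] with x hx
  linarith [hle x₀ x hx₀Y hx]

theorem exists_forall_scaled_le_of_regVar {b : ℝ → ℝ} {α : ℝ} (hα : 0 < α) (hc : Continuous b)
    (hnn : ∀ x, 0 ≤ b x)
    (hrv : ∀ c : ℝ, 0 < c → Tendsto (fun x => b (c * x) / b x) atTop (𝓝 (c ^ α))) :
    ∃ M, ∀ᶠ x in atTop, ∀ s ∈ Icc (0 : ℝ) 1, b (s * x) ≤ M * b x := by
  obtain ⟨Y, hY, hle⟩ := exists_le_mul_of_regVar hα hc hnn hrv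
  obtain ⟨ε, hε, hlow⟩ := exists_pos_le_of_regVar hα hc hnn hrv
  obtain ⟨m, hm⟩ := (isCompact_Icc (a := (0 : ℝ)) (b := Y)).bddAbove_image hc.continuousOn
  have hm0 : 0 ≤ m := (hnn 0).trans (hm ⟨0, ⟨le_rfl, hY.le⟩, rfl⟩)
  refine ⟨4 + m / ε, ?_⟩
  filter_upwards [hlow, eventually_ge_atTop 0] with x hx hx0 s hs
  have hmε : 0 ≤ m / ε := by positivity
  rcases le_total Y (s * x) with h | h
  · have := hle _ x h (mul_le_of_le_one_left hx0 hs.2)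
    nlinarith [hnn x]
  · have h1 : b (s * x) ≤ m := hm ⟨s * x, ⟨mul_nonneg hs.1 hx0, h⟩, rfl⟩
    have h2 : m / ε * ε = m := by field_simp
    nlinarith [hnn x]

/-- Karamata's theorem for the primitive of a regularly varying function. -/
theorem tendsto_mul_div_integral_of_regVar {b : ℝ → ℝ} {α : ℝ} (hα : 0 < α) (hc : Continuous b)
    (hnn : ∀ x, 0 ≤ b x)
    (hrv : ∀ c : ℝ, 0 < c → Tendsto (fun x => b (c * x) / b x) atTop (𝓝 (c ^ α))) :
    Tendsto (fun x => x * b x / ∫ t in (0 : ℝ)..x, b t) atTop (𝓝 (α + 1)) := by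
  obtain ⟨M, hM⟩ := exists_forall_scaled_le_of_regVar hα hc hnn hrv
  have hlim : Tendsto (fun x => ∫ s in (0 : ℝ)..1, b (s * x) / b x) atTop
      (𝓝 (∫ s in (0 : ℝ)..1, s ^ α)) := by
    refine intervalIntegral.tendsto_integral_filter_of_dominated_convergence (fun _ => M)
      (Eventually.of_forall fun x => Continuous.aestronglyMeasurable (by fun_prop)) ?_
      intervalIntegrable_const ?_
    · filter_upwards [hM, eventually_pos_of_regVar hnn hrv] with x hx hp
      refine Eventually.of_forall fun s hs => ?_
      rw [uIoc_of_le zero_le_one] at hs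
      rw [norm_of_nonneg (div_nonneg (hnn _) hp.le), div_le_iff₀ hp]
      exact hx s ⟨hs.1.le, hs.2⟩
    · refine Eventually.of_forall fun s hs => ?_
      rw [uIoc_of_le zero_le_one] at hs
      exact hrv s hs.1
  have hval : ∫ s in (0 : ℝ)..1, s ^ α = (α + 1)⁻¹ := by
    rw [integral_rpow (Or.inl (by linarith)), one_rpow, zero_rpow (by linarith)]
    simp
  rw [hval] at hlim
  have hinv := hlim.inv₀ (by positivity)
  rw [inv_inv] at hinv
  refine hinv.congr' ?_
  filter_upwards [eventually_gt_atTop 0] with x hx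
  rw [intervalIntegral.integral_div, intervalIntegral.integral_comp_mul_right _ hx.ne']
  simp only [zero_mul, one_mul, smul_eq_mul, inv_div]
  field_simp

/-- The rule of Bernoulli for the indeterminate form infinity over infinity. -/
theorem tendsto_div_of_tendsto_deriv_div {F F' G G' : ℝ → ℝ} {L : ℝ}
    (hF : ∀ᶠ x in atTop, HasDerivAt F (F' x) x) (hG : ∀ᶠ x in atTop, HasDerivAt G (G' x) x)
    (hG' : ∀ᶠ x in atTop, 0 < G' x) (hGtop : Tendsto G atTop atTop)
    (hlim : Tendsto (fun x => F' x / G' x) atTop (𝓝 L)) :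
    Tendsto (fun x => F x / G x) atTop (𝓝 L) := by
  have upper : ∀ {F F' : ℝ → ℝ} {L : ℝ}, (∀ᶠ x in atTop, HasDerivAt F (F' x) x) →
      Tendsto (fun x => F' x / G' x) atTop (𝓝 L) → ∀ r > L, ∀ᶠ x in atTop, F x / G x < r := by
    intro F F' L hF hlim r hr
    obtain ⟨q, hq, hqr⟩ := exists_between hr
    obtain ⟨X, hX⟩ := eventually_atTop.1
      ((hF.and hG).and (hG'.and (hlim.eventually (gt_mem_nhds hq))))
    have hd : ∀ x ≥ X, HasDerivAt (fun y => q * G y - F y) (q * G' x - F' x) x := fun x hx =>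
      ((hX x hx).1.2.const_mul q).sub (hX x hx).1.1
    have hmono : MonotoneOn (fun y => q * G y - F y) (Ici X) := by
      refine monotoneOn_of_deriv_nonneg (convex_Ici X)
        (fun x hx => (hd x hx).continuousAt.continuousWithinAt)
        (fun x hx => (hd x (interior_subset hx)).differentiableAt.differentiableWithinAt)
        fun x hx => ?_
      have hx' : X ≤ x := interior_subset hx
      rw [(hd x hx').deriv]
      have := (div_lt_iff₀ (hX x hx').2.1).1 (hX x hx').2.2
      linarith
    filter_upwards [eventually_ge_atTop X, hGtop.eventually_gt_atTop 0,
      (hGtop.const_mul_atTop (sub_pos.2 hqr)).eventually_gt_atTop (F X - q * G X)] with x hx h0 h1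
    have := hmono (mem_Ici.2 le_rfl) hx hx
    rw [div_lt_iff₀ h0]
    simp only at this
    linarith
  refine tendsto_order.2 ⟨fun r hr => ?_, upper hF hlim⟩
  have hneg : Tendsto (fun x => -F' x / G' x) atTop (𝓝 (-L)) := by
    simpa [neg_div] using hlim.neg
  filter_upwards [upper (F := fun x => -F x) (hF.mono fun x hx => hx.neg) hneg (-r) (by linarith)]
    with x hx
  rw [neg_div] at hx
  linarith

/-- A regularly varying function of positive index is asymptotically equivalent to a smooth function
whose second derivative is negligible compared with its first derivative. -/
theorem exists_smooth_equivalent_of_regVar {b : ℝ → ℝ} {α : ℝ} (hα : 0 < α) (hc : Continuous b)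
    (hs : ContDiffOn ℝ (⊤ : ℕ∞) b (Ioi 0)) (hnn : ∀ x, 0 ≤ b x)
    (hrv : ∀ c : ℝ, 0 < c → Tendsto (fun x => b (c * x) / b x) atTop (𝓝 (c ^ α))) :
    ∃ K k k' : ℝ → ℝ, ContDiffOn ℝ (⊤ : ℕ∞) K (Ioi 1) ∧ (∀ x, HasDerivAt K (k x) x) ∧
      (∀ x > 1, HasDerivAt k (k' x) x) ∧ (∀ᶠ x in atTop, 0 < k x) ∧
      Tendsto (fun x => k' x / k x) atTop (𝓝 0) ∧ Tendsto K atTop atTop ∧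
      Tendsto (fun x => b x / K x) atTop (𝓝 1) := by
  set G : ℝ → ℝ := fun x => ∫ t in (0 : ℝ)..x, b t with hGdef
  have hGd : ∀ x, HasDerivAt G (b x) x := fun x =>
    intervalIntegral.integral_hasDerivAt_right (hc.intervalIntegrable _ _)
      hc.aestronglyMeasurable.stronglyMeasurableAtFilter hc.continuousAt
  have hGc : Continuous G := continuous_iff_continuousAt.2 fun x => (hGd x).continuousAt
  have hGs : ContDiffOn ℝ (⊤ : ℕ∞) G (Ioi 0) := by
    refine (contDiffOn_infty_iff_deriv_of_isOpen isOpen_Ioi).2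
      ⟨fun x _ => (hGd x).differentiableAt.differentiableWithinAt, ?_⟩
    rwa [show deriv G = b from funext fun x => (hGd x).deriv]
  have hbG : Tendsto (fun x => x * b x / G x) atTop (𝓝 (α + 1)) :=
    tendsto_mul_div_integral_of_regVar hα hc hnn hrv
  have hGpos : ∀ᶠ x in atTop, 0 < G x := by
    filter_upwards [hbG.eventually (lt_mem_nhds (show 0 < α + 1 by linarith)),
      eventually_gt_atTop 0] with x hx hx0
    refine lt_of_le_of_ne (intervalIntegral.integral_nonneg hx0.le fun t _ => hnn t) fun h0 => ?_
    simp [← h0] at hx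
  have hA : 0 < α * (α + 1) := by positivity
  set A := α * (α + 1) with hAdef
  let k : ℝ → ℝ := fun x => A * G (max x 1) / max x 1 ^ 2
  let k' : ℝ → ℝ := fun x => A * (b x / x ^ 2 - 2 * G x / x ^ 3)
  let K : ℝ → ℝ := fun x => ∫ t in (1 : ℝ)..x, k t
  have hk_eq : ∀ x, 1 < x → k x = A * G x / x ^ 2 := fun x hx => by
    simp only [k, max_eq_left hx.le]
  have hkc : Continuous k := by
    refine Continuous.div (by fun_prop) (by fun_prop) fun x => ?_
    have : (0 : ℝ) < max x 1 := lt_max_of_lt_right one_pos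
    positivity
  have hks : ContDiffOn ℝ (⊤ : ℕ∞) k (Ioi 1) := by
    have h : ContDiffOn ℝ (⊤ : ℕ∞) (fun x => A * G x / x ^ 2) (Ioi 1) := by
      refine ContDiffOn.div (contDiffOn_const.mul
        (hGs.mono (Ioi_subset_Ioi zero_le_one))) (by fun_prop) fun x hx => ?_
      have : (0 : ℝ) < x := one_pos.trans hx
      positivity
    exact h.congr fun x hx => hk_eq x hx
  have hKd : ∀ x, HasDerivAt K (k x) x := fun x =>
    intervalIntegral.integral_hasDerivAt_right (hkc.intervalIntegrable _ _)
      hkc.aestronglyMeasurable.stronglyMeasurableAtFilter hkc.continuousAt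
  have hKs : ContDiffOn ℝ (⊤ : ℕ∞) K (Ioi 1) := by
    refine (contDiffOn_infty_iff_deriv_of_isOpen isOpen_Ioi).2
      ⟨fun x _ => (hKd x).differentiableAt.differentiableWithinAt, ?_⟩
    rwa [show deriv K = k from funext fun x => (hKd x).deriv]
  have hkd : ∀ x > 1, HasDerivAt k (k' x) x := fun x hx => by
    have hx0 : x ≠ 0 := by linarith
    have h := ((hGd x).const_mul A).div (hasDerivAt_pow 2 x) (pow_ne_zero 2 hx0)
    refine (h.congr_of_eventuallyEq ?_).congr_deriv ?_
    · filter_upwards [lt_mem_nhds hx] with y hy using hk_eq y hy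
    · simp only [k']
      field_simp
      ring
  have hkpos : ∀ᶠ x in atTop, 0 < k x := by
    filter_upwards [hGpos, eventually_gt_atTop 1] with x hx hx1
    rw [hk_eq x hx1]
    have : (0 : ℝ) < x := one_pos.trans hx1
    positivity
  have hratio : Tendsto (fun x => k' x / k x) atTop (𝓝 0) := by
    have h := (hbG.sub_const 2).mul tendsto_inv_atTop_zero
    rw [mul_zero] at h
    refine h.congr' ?_
    filter_upwards [hGpos, eventually_gt_atTop 1] with x hx hx1
    have : x ≠ 0 := by linarith
    rw [hk_eq x hx1]
    simp only [k']
    field_simp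
  have hKtop : Tendsto K atTop atTop := by
    obtain ⟨ε, hε, hlow⟩ := exists_pos_le_of_regVar hα hc hnn hrv
    have hkl : ∀ᶠ x in atTop, ε * α / 2 * x⁻¹ ≤ k x := by
      have h2 : α + 1 < 2 * (α + 1) := by linarith
      filter_upwards [hGpos, eventually_gt_atTop 1, hlow, hbG.eventually (gt_mem_nhds h2)]
        with x hx hx1 hεx hb
      have hx0 : 0 < x := by linarith
      rw [hk_eq x hx1]
      rw [div_lt_iff₀ hx] at hb
      rw [← div_eq_mul_inv, div_le_div_iff₀ hx0 (by positivity), hAdef]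
      have h3 : ε * x ≤ x * b x := by nlinarith
      have h4 : α * x / 2 * (ε * x) ≤ α * x / 2 * (2 * (α + 1) * G x) :=
        mul_le_mul_of_nonneg_left (h3.trans hb.le) (by positivity)
      nlinarith
    obtain ⟨X, hX⟩ := eventually_atTop.1 (hkl.and (eventually_gt_atTop 1))
    have hd : ∀ x ≥ X, HasDerivAt (fun y => K y - ε * α / 2 * log y)
        (k x - ε * α / 2 * x⁻¹) x := fun x hx =>
      (hKd x).sub ((hasDerivAt_log (by linarith [(hX x hx).2])).const_mul _)
    have hmono : MonotoneOn (fun y => K y - ε * α / 2 * log y) (Ici X) := by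
      refine monotoneOn_of_deriv_nonneg (convex_Ici X)
        (fun x hx => (hd x hx).continuousAt.continuousWithinAt)
        (fun x hx => (hd x (interior_subset hx)).differentiableAt.differentiableWithinAt)
        fun x hx => ?_
      have hx' : X ≤ x := interior_subset hx
      rw [(hd x hx').deriv]
      linarith [(hX x hx').1]
    have hlog : Tendsto (fun x => ε * α / 2 * log x + (K X - ε * α / 2 * log X)) atTop atTop :=
      tendsto_atTop_add_const_right _ _ (tendsto_log_atTop.const_mul_atTop (by positivity))
    refine tendsto_atTop_mono' _ ?_ hlog
    filter_upwards [eventually_ge_atTop X] with x hx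
    have := hmono (mem_Ici.2 le_rfl) hx hx
    simp only at this
    linarith
  have hg : Tendsto (fun x => G x / x / K x) atTop (𝓝 (α / A)) := by
    refine tendsto_div_of_tendsto_deriv_div (F' := fun x => (b x * x - G x * 1) / x ^ 2)
      ?_ (Eventually.of_forall hKd) hkpos hKtop ?_
    · filter_upwards [eventually_gt_atTop 0] with x hx
      exact (hGd x).div (hasDerivAt_id x) hx.ne'
    · have h := (hbG.sub_const 1).div_const A
      rw [add_sub_cancel_right] at h
      refine h.congr' ?_
      filter_upwards [hGpos, eventually_gt_atTop 1] with x hx hx1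
      have : x ≠ 0 := by linarith
      rw [hk_eq x hx1]
      field_simp
  refine ⟨K, k, k', hKs, hKd, hkd, hkpos, hratio, hKtop, ?_⟩
  have h := hbG.mul hg
  rw [show (α + 1) * (α / A) = 1 by rw [hAdef]; field_simp] at h
  refine h.congr' ?_
  filter_upwards [hGpos, eventually_gt_atTop 1] with x hx hx1
  have : x ≠ 0 := by linarith
  field_simp

theorem ConcaveOn.map_mul_le {f : ℝ → ℝ} (hf : ConcaveOn ℝ (Ici 0) f) (h0 : f 0 = 0) {a x : ℝ}
    (ha : 1 ≤ a) (hx : 0 ≤ x) : f (a * x) ≤ a * f x := by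
  have ha0 : 0 < a := by linarith
  have h := hf.2 (mem_Ici.2 (show 0 ≤ a * x by positivity)) (mem_Ici.2 le_rfl)
    (inv_nonneg.2 ha0.le) (sub_nonneg.2 (inv_le_one_of_one_le₀ ha)) (add_sub_cancel a⁻¹ 1)
  simp only [smul_eq_mul, h0, mul_zero, add_zero, inv_mul_cancel_left₀ ha0.ne'] at h
  rwa [inv_mul_le_iff₀ ha0] at h

theorem ConcaveOn.map_add_le {f : ℝ → ℝ} (hf : ConcaveOn ℝ (Ici 0) f) (h0 : f 0 = 0) {x y : ℝ}
    (hx : 0 < x) (hy : 0 < y) : f (x + y) ≤ f x + f y := by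
  have h1 := hf.map_mul_le h0 (a := (x + y) / x) (by rw [one_le_div hx]; linarith) hx.le
  have h2 := hf.map_mul_le h0 (a := (x + y) / y) (by rw [one_le_div hy]; linarith) hy.le
  rw [div_mul_cancel₀ _ hx.ne', div_mul_eq_mul_div, le_div_iff₀ hx] at h1
  rw [div_mul_cancel₀ _ hy.ne', div_mul_eq_mul_div, le_div_iff₀ hy] at h2
  have : (x + y) * f (x + y) ≤ (x + y) * (f x + f y) := by linarith
  exact le_of_mul_le_mul_left this (by linarith)

/-- If `K` is smooth, eventually increasing, and its second derivative is negligible compared with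
its first derivative, then a shift of `K ∘ log` is concave on the half-line. -/
theorem exists_concave_of_deriv_ratio {K k k' : ℝ → ℝ} (hKs : ContDiffOn ℝ (⊤ : ℕ∞) K (Ioi 1))
    (hK : ∀ x, HasDerivAt K (k x) x) (hk : ∀ x > 1, HasDerivAt k (k' x) x)
    (hkpos : ∀ᶠ x in atTop, 0 < k x) (hratio : Tendsto (fun x => k' x / k x) atTop (𝓝 0))
    (hKtop : Tendsto K atTop atTop) :
    ∃ f : ℝ → ℝ, ContDiffOn ℝ (⊤ : ℕ∞) f (Ici 0) ∧ MonotoneOn f (Ici 0) ∧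
      ConcaveOn ℝ (Ici 0) f ∧ f 0 = 0 ∧ (∃ L : ℝ, Tendsto (fun x => f x / x) (𝓝[>] 0) (𝓝 L)) ∧
      Tendsto f atTop atTop ∧ Tendsto (fun x => K (log x) / f x) atTop (𝓝 1) := by
  obtain ⟨U, hU⟩ := eventually_atTop.1 ((eventually_gt_atTop 1).and
    (hkpos.and (hratio.eventually (gt_mem_nhds one_pos))))
  have hU1 : 1 < U := (hU U le_rfl).1
  have hφ : AntitoneOn (fun u => k u * exp (-u)) (Ici U) := by
    have hd : ∀ u ≥ U, HasDerivAt (fun u => k u * exp (-u))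
        (k' u * exp (-u) + k u * (exp (-u) * -1)) u := fun u hu =>
      (hk u (hU u hu).1).mul (hasDerivAt_neg u).exp
    refine antitoneOn_of_deriv_nonpos (convex_Ici U)
      (fun x hx => (hd x hx).continuousAt.continuousWithinAt)
      (fun x hx => (hd x (interior_subset hx)).differentiableAt.differentiableWithinAt)
      fun x hx => ?_
    have hx' : U ≤ x := interior_subset hx
    rw [(hd x hx').deriv]
    have := (div_lt_iff₀ (hU x hx').2.1).1 (hU x hx').2.2
    nlinarith [exp_pos (-x)]
  have hpos : ∀ x, 0 ≤ x → 0 < exp U + x := fun x hx => by positivity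
  have hlog : ∀ x, 0 ≤ x → U ≤ log (exp U + x) := fun x hx => by
    rw [le_log_iff_exp_le (hpos x hx)]
    linarith
  let f : ℝ → ℝ := fun x => K (log (exp U + x)) - K U
  have hf0 : f 0 = 0 := by simp [f]
  have hfd : ∀ x, 0 ≤ x → HasDerivAt f (k (log (exp U + x)) * exp (-log (exp U + x))) x := by
    intro x hx
    have h1 := ((hasDerivAt_id x).const_add (exp U)).log (hpos x hx).ne'
    refine (((hK _).comp x h1).sub_const (K U)).congr_deriv ?_
    rw [exp_neg, exp_log (hpos x hx)]
    simp
  have hfc : ContinuousOn f (Ici 0) := fun x hx => (hfd x hx).continuousAt.continuousWithinAt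
  have hfdiff : DifferentiableOn ℝ f (interior (Ici 0)) := fun x hx =>
    (hfd x (interior_subset hx)).differentiableAt.differentiableWithinAt
  have hmono : MonotoneOn f (Ici 0) := by
    refine monotoneOn_of_deriv_nonneg (convex_Ici 0) hfc hfdiff fun x hx => ?_
    have hx' : 0 ≤ x := interior_subset hx
    rw [(hfd x hx').deriv]
    have := (hU _ (hlog x hx')).2.1
    positivity
  have hconc : ConcaveOn ℝ (Ici 0) f := by
    refine AntitoneOn.concaveOn_of_deriv (convex_Ici 0) hfc hfdiff fun x hx y hy hxy => ?_
    have hx' : 0 ≤ x := interior_subset hx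
    have hy' : 0 ≤ y := interior_subset hy
    rw [(hfd x hx').deriv, (hfd y hy').deriv]
    exact hφ (hlog x hx') (hlog y hy') (log_le_log (hpos x hx') (by linarith))
  have hftop : Tendsto f atTop atTop :=
    tendsto_atTop_add_const_right _ _ (hKtop.comp (tendsto_log_atTop.comp
      (tendsto_atTop_add_const_left _ _ tendsto_id)))
  have hsmooth : ContDiffOn ℝ (⊤ : ℕ∞) f (Ici 0) := by
    refine ContDiffOn.sub (hKs.comp (t := Ioi 1) (ContDiffOn.log (by fun_prop)
      fun x hx => (hpos x hx).ne') fun x hx => ?_) contDiffOn_const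
    exact hU1.trans_le (hlog x hx)
  have hslope : Tendsto (fun x => f x / x) (𝓝[>] 0)
      (𝓝 (k (log (exp U + 0)) * exp (-log (exp U + 0)))) := by
    have h := (hasDerivAt_iff_tendsto_slope.1 (hfd 0 le_rfl)).mono_left
      (nhdsWithin_mono 0 fun x (hx : 0 < x) => hx.ne')
    refine h.congr fun x => ?_
    rw [slope_def_field, hf0, sub_zero, sub_zero]
  refine ⟨f, hsmooth, hmono, hconc, hf0, ⟨_, hslope⟩, hftop, ?_⟩
  have hKf : ∀ x, exp U ≤ x → K (log x) = f (x - exp U) + K U := fun x hx => by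
    simp [f]
  have hinv : Tendsto (fun x => (f x)⁻¹) atTop (𝓝 0) := tendsto_inv_atTop_zero.comp hftop
  have hlow : Tendsto (fun x => 1 + (K U - f (exp U)) * (f x)⁻¹) atTop (𝓝 1) := by
    simpa using (hinv.const_mul (K U - f (exp U))).const_add 1
  have hupp : Tendsto (fun x => 1 + K U * (f x)⁻¹) atTop (𝓝 1) := by
    simpa using (hinv.const_mul (K U)).const_add 1
  refine tendsto_of_tendsto_of_tendsto_of_le_of_le' hlow hupp ?_ ?_
  · filter_upwards [eventually_gt_atTop (exp U), hftop.eventually_gt_atTop 0] with x hx hfx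
    have h := hconc.map_add_le hf0 (sub_pos.2 hx) (exp_pos U)
    rw [sub_add_cancel] at h
    rw [hKf x hx.le, le_div_iff₀ hfx]
    field_simp
    linarith
  · filter_upwards [eventually_gt_atTop (exp U), hftop.eventually_gt_atTop 0] with x hx hfx
    have h : f (x - exp U) ≤ f x := hmono (mem_Ici.2 (sub_pos.2 hx).le)
      (mem_Ici.2 ((exp_pos U).trans hx).le) (by linarith [exp_pos U])
    rw [hKf x hx.le, div_le_iff₀ hfx]
    field_simp
    linarith

/-- Quasi-subadditivity of `b` passes to `f ∘ exp`, in multiplicative form. -/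
theorem exists_map_mul_le {b f : ℝ → ℝ} {C : ℝ} (hmono : MonotoneOn f (Ici 0))
    (hconc : ConcaveOn ℝ (Ici 0) f) (hf0 : f 0 = 0) (hftop : Tendsto f atTop atTop)
    (hbf : Tendsto (fun x => b (log x) / f x) atTop (𝓝 1))
    (hsub : ∀ x ∈ Ici (0 : ℝ), ∀ y ∈ Ici (0 : ℝ), b (x + y) ≤ C * (b x + b y)) :
    ∃ C' : ℝ, ∀ x ∈ Ici (0 : ℝ), ∀ y ∈ Ici (0 : ℝ), f (x * y) ≤ C' * (f x + f y) := by
  have hfnn : ∀ x, 0 ≤ x → 0 ≤ f x := fun x hx => hf0 ▸ hmono (mem_Ici.2 le_rfl) hx hx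
  obtain ⟨X, hX⟩ := eventually_atTop.1 ((hftop.eventually_gt_atTop 0).and
    ((hbf.eventually (gt_mem_nhds one_lt_two)).and
      (hbf.eventually (lt_mem_nhds (show (1 / 2 : ℝ) < 1 by norm_num)))))
  set a := max X 1 with ha
  have ha1 : 1 ≤ a := le_max_right _ _
  have ha0 : 0 < a := by linarith
  have hub : ∀ x ≥ a, f x ≤ 2 * b (log x) ∧ b (log x) ≤ 2 * f x := fun x hx => by
    obtain ⟨h0, h1, h2⟩ := hX x ((le_max_left _ _).trans hx)
    rw [div_lt_iff₀ h0] at h1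
    rw [lt_div_iff₀ h0] at h2
    constructor <;> linarith
  refine ⟨max 1 (4 * |C| * a), fun x hx y hy => ?_⟩
  rw [mem_Ici] at hx hy
  have hsum : 0 ≤ f x + f y := add_nonneg (hfnn x hx) (hfnn y hy)
  have hone : f x + f y ≤ max 1 (4 * |C| * a) * (f x + f y) :=
    le_mul_of_one_le_left hsum (le_max_left _ _)
  rcases le_total x 1 with hx1 | hx1
  · have : f (x * y) ≤ f y := hmono (mul_nonneg hx hy) hy (mul_le_of_le_one_left hy hx1)
    linarith [hfnn x hx]
  rcases le_total y 1 with hy1 | hy1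
  · have : f (x * y) ≤ f x := hmono (mul_nonneg hx hy) hx (mul_le_of_le_one_right hx hy1)
    linarith [hfnn y hy]
  have hax : a ≤ a * x := le_mul_of_one_le_right ha0.le hx1
  have hay : a ≤ a * y := le_mul_of_one_le_right ha0.le hy1
  have hx0 : 0 < a * x := by linarith
  have hy0 : 0 < a * y := by linarith
  have hprod : a ≤ a * x * (a * y) := hax.trans (le_mul_of_one_le_right hx0.le (ha1.trans hay))
  have hle : x * y ≤ a * x * (a * y) :=
    mul_le_mul (le_mul_of_one_le_left hx ha1) (le_mul_of_one_le_left hy ha1) hy hx0.le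
  have hnn : 0 ≤ b (log (a * x)) + b (log (a * y)) := by
    linarith [(hub _ hax).1, (hub _ hay).1, hfnn _ hx0.le, hfnn _ hy0.le]
  calc f (x * y) ≤ f (a * x * (a * y)) := hmono (mul_nonneg hx hy) (mul_pos hx0 hy0).le hle
    _ ≤ 2 * b (log (a * x) + log (a * y)) := by
      rw [← log_mul hx0.ne' hy0.ne']
      exact (hub _ hprod).1
    _ ≤ 2 * (C * (b (log (a * x)) + b (log (a * y)))) := by
      gcongr
      exact hsub _ (log_nonneg (ha1.trans hax)) _ (log_nonneg (ha1.trans hay))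
    _ ≤ 2 * (|C| * (b (log (a * x)) + b (log (a * y)))) := by
      gcongr
      exact le_abs_self C
    _ ≤ 2 * (|C| * (2 * f (a * x) + 2 * f (a * y))) := by
      gcongr
      exacts [(hub _ hax).2, (hub _ hay).2]
    _ ≤ 2 * (|C| * (2 * (a * f x) + 2 * (a * f y))) := by
      gcongr
      exacts [hconc.map_mul_le hf0 ha1 hx, hconc.map_mul_le hf0 ha1 hy]
    _ = 4 * |C| * a * (f x + f y) := by ring
    _ ≤ max 1 (4 * |C| * a) * (f x + f y) := by
      gcongr
      exact le_max_right _ _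

/-- Let `b : [0,∞) → [0,∞)` be smooth, regularly varying at infinity with exponent
`α > 0`, and satisfy `b (x+y) ≤ C (b x + b y)` for all `x, y ≥ 0`.  Then there is a
smooth nondecreasing concave function `f` on `[0,∞)` with `f 0 = 0`, finite right
derivative at `0`, `f → ∞`, such that `b (log x) ∼ f x` as `x → ∞` and
`f (x*y) ≤ C' (f x + f y)` for all `x, y ≥ 0` and some constant `C'`. -/
theorem exists_concave_equivalent
    (b : ℝ → ℝ) (α C : ℝ) (hα : 0 < α)
    (hb_smooth : ContDiffOn ℝ (⊤ : ℕ∞) b (Ici (0:ℝ)))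
    (hb_nonneg : ∀ x ∈ Ici (0:ℝ), 0 ≤ b x)
    (hb_rv : ∀ c : ℝ, 0 < c →
      Tendsto (fun x : ℝ => b (c * x) / b x) atTop (𝓝 (c ^ α)))
    (hb_sub : ∀ x ∈ Ici (0:ℝ), ∀ y ∈ Ici (0:ℝ), b (x + y) ≤ C * (b x + b y)) :
    ∃ f : ℝ → ℝ, ∃ C' : ℝ,
      ContDiffOn ℝ (⊤ : ℕ∞) f (Ici (0:ℝ)) ∧
      MonotoneOn f (Ici (0:ℝ)) ∧
      ConcaveOn ℝ (Ici (0:ℝ)) f ∧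
      f 0 = 0 ∧
      (∃ L : ℝ, Tendsto (fun x : ℝ => f x / x) (𝓝[>] (0:ℝ)) (𝓝 L)) ∧
      Tendsto f atTop atTop ∧
      Tendsto (fun x : ℝ => b (Real.log x) / f x) atTop (𝓝 1) ∧
      (∀ x ∈ Ici (0:ℝ), ∀ y ∈ Ici (0:ℝ), f (x * y) ≤ C' * (f x + f y)) := by
  have hmax : ∀ x : ℝ, 0 ≤ x → b (max x 0) = b x := fun x hx => by rw [max_eq_left hx]
  have hcont : Continuous fun x => b (max x 0) :=
    hb_smooth.continuousOn.comp_continuous (by fun_prop) fun x => le_max_right x 0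
  have hsmooth : ContDiffOn ℝ (⊤ : ℕ∞) (fun x => b (max x 0)) (Ioi 0) :=
    (hb_smooth.mono Ioi_subset_Ici_self).congr fun x hx => hmax x (le_of_lt hx)
  have hrv : ∀ c : ℝ, 0 < c →
      Tendsto (fun x => b (max (c * x) 0) / b (max x 0)) atTop (𝓝 (c ^ α)) := fun c hc => by
    refine (hb_rv c hc).congr' ?_
    filter_upwards [eventually_ge_atTop 0] with x hx
    rw [hmax x hx, hmax _ (mul_nonneg hc.le hx)]
  obtain ⟨K, k, k', hKs, hKd, hkd, hkpos, hratio, hKtop, hbK⟩ :=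
    exists_smooth_equivalent_of_regVar hα hcont hsmooth
      (fun x => hb_nonneg _ (le_max_right x 0)) hrv
  obtain ⟨f, hfs, hmono, hconc, hf0, hslope, hftop, hKf⟩ :=
    exists_concave_of_deriv_ratio hKs hKd hkd hkpos hratio hKtop
  have hbf : Tendsto (fun x => b (log x) / f x) atTop (𝓝 1) := by
    have h := (hbK.comp tendsto_log_atTop).mul hKf
    rw [one_mul] at h
    refine h.congr' ?_
    filter_upwards [eventually_ge_atTop 1,
      (hKtop.comp tendsto_log_atTop).eventually_gt_atTop 0] with x hx hKx
    have hKx' : 0 < K (log x) := hKx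
    rw [Function.comp_apply, hmax _ (log_nonneg hx), div_mul_div_cancel₀ hKx'.ne']
  obtain ⟨C', hC'⟩ := exists_map_mul_le hmono hconc hf0 hftop hbf hb_sub
  exact ⟨f, C', hfs, hmono, hconc, hf0, hslope, hftop, hbf, hC'⟩
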